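/- arXiv:1103.0151 — 5 statements merged into one kernel-verified Lean document; each statement's English description precedes it below -/
import Mathlib

section
/- The set of 3-admissible data (g', N; d_1, …, d_{N−1}) with base genus g' ≥ 1 consists of exactly the following four tuples: (1, 2; 4), (1, 3; 1, 1), (1, 4; 0, 2, 0), and (2, 2; 0). -/
open Finset

/-- `dGet d i` is the entry `d_i` (1-indexed) of the tuple encoded by the list `d`. -/
def dGet (d : List ℕ) (i : ℕ) : ℕ := d.getD (i - 1) 0

/-- `IsAdmissible g g' N d` says that `(g', N; d_1, …, d_{N-1})` is a `g`-admissible datum: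
`N ≥ 2`, `g' ≤ g`, the list `d` has length `N - 1`, the Riemann–Hurwitz equation
`2g - 2 = N(2g' - 2) + Σ_{i=1}^{N-1} d_i · gcd(i,N) · (N/gcd(i,N) - 1)` holds, and
`Σ_{i=1}^{N-1} i·d_i ≡ 0 (mod N)`. -/
def IsAdmissible (g gp N : ℕ) (d : List ℕ) : Prop :=
  2 ≤ N ∧ gp ≤ g ∧ d.length = N - 1 ∧
  (2 * (g : ℤ) - 2 = (N : ℤ) * (2 * (gp : ℤ) - 2) +
     ∑ i ∈ Finset.Icc 1 (N - 1),
       (dGet d i : ℤ) * (Nat.gcd i N : ℤ) * (((N / Nat.gcd i N : ℕ) : ℤ) - 1)) ∧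
  (N : ℤ) ∣ ∑ i ∈ Finset.Icc 1 (N - 1), (i : ℤ) * (dGet d i : ℤ)

/-- `kOf N d` is the greatest common divisor of `N` together with all indices
`i ∈ {1, …, N-1}` such that `d_i ≠ 0`. -/
def kOf (N : ℕ) (d : List ℕ) : ℕ :=
  Nat.gcd N (((Finset.Icc 1 (N - 1)).filter (fun i => dGet d i ≠ 0)).gcd id)

theorem term_bound (N i x : ℕ) (h1 : 1 ≤ i) (h2 : i < N) :
    0 ≤ (x : ℤ) * (Nat.gcd i N : ℤ) * (((N / Nat.gcd i N : ℕ) : ℤ) - 1) ∧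
    (x ≠ 0 → (N : ℤ) ≤ 2 * ((x : ℤ) * (Nat.gcd i N : ℤ) * (((N / Nat.gcd i N : ℕ) : ℤ) - 1))) := by
  have hg : 0 < Nat.gcd i N := Nat.gcd_pos_of_pos_left _ h1
  have hle : Nat.gcd i N ≤ i := Nat.gcd_le_left _ h1
  have hk : Nat.gcd i N * (N / Nat.gcd i N) = N := Nat.mul_div_cancel' (Nat.gcd_dvd_right i N)
  generalize N / Nat.gcd i N = k at *
  generalize Nat.gcd i N = g at *
  have hk2 : 2 ≤ k := by
    by_contra hc
    have : g * k ≤ g * 1 := Nat.mul_le_mul_left g (by omega)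
    omega
  obtain ⟨m, rfl⟩ : ∃ m, k = m + 2 := ⟨k - 2, by omega⟩
  subst hk
  push_cast
  have e : (m : ℤ) + 2 - 1 = m + 1 := by ring
  rw [e]
  refine ⟨by positivity, fun hx => ?_⟩
  obtain ⟨y, rfl⟩ := Nat.exists_eq_succ_of_ne_zero hx
  push_cast
  have : 0 ≤ (y : ℤ) * g * (m + 1) := by positivity
  have : 0 ≤ (g : ℤ) * m := by positivity
  linarith

/-- The `3`-admissible data with base genus `g' ≥ 1` are exactly
`(1,2;4)`, `(1,3;1,1)`, `(1,4;0,2,0)` and `(2,2;0)`. -/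
theorem genus3_admissible_positive_base (gp N : ℕ) (d : List ℕ) :
    (IsAdmissible 3 gp N d ∧ 1 ≤ gp) ↔
      ((gp, N, d) = (1, 2, [4]) ∨ (gp, N, d) = (1, 3, [1, 1]) ∨
       (gp, N, d) = (1, 4, [0, 2, 0]) ∨ (gp, N, d) = (2, 2, [0])) := by
  constructor
  · rintro ⟨⟨hN, hgp, hlen, hRH, hmod⟩, h1⟩
    have hnn : ∀ i ∈ Finset.Icc 1 (N - 1), 0 ≤ (dGet d i : ℤ) * (Nat.gcd i N : ℤ) *
        (((N / Nat.gcd i N : ℕ) : ℤ) - 1) := by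
      intro i hi
      rw [Finset.mem_Icc] at hi
      exact (term_bound N i _ hi.1 (by omega)).1
    have hs := Finset.sum_nonneg hnn
    have hN8 : N ≤ 8 := by
      by_cases hz : (∑ i ∈ Finset.Icc 1 (N - 1), (dGet d i : ℤ) * (Nat.gcd i N : ℤ) *
        (((N / Nat.gcd i N : ℕ) : ℤ) - 1)) = 0
      · rw [hz] at hRH
        interval_cases gp <;> omega
      · obtain ⟨i, hi, hne⟩ := Finset.exists_ne_zero_of_sum_ne_zero hz
        have hl := Finset.single_le_sum hnn hi
        rw [Finset.mem_Icc] at hi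
        have hb := (term_bound N i (dGet d i) hi.1 (by omega)).2 (by
          intro h0
          simp [h0] at hne)
        interval_cases gp <;> omega
    clear hnn
    have hgN : (gp = 1) ∨ (gp = 2 ∧ N = 2) := by
      interval_cases gp <;> omega
    clear hs
    have hI : ∀ m, Finset.Icc 1 m = (Finset.range m).image (· + 1) := by
      intro m
      ext x
      simp only [Finset.mem_Icc, Finset.mem_image, Finset.mem_range]
      exact ⟨fun h => ⟨x - 1, by omega, by omega⟩, by rintro ⟨a, h, rfl⟩; omega⟩
    have hS : ∀ (m : ℕ) (f : ℕ → ℤ), ∑ i ∈ Finset.Icc 1 m, f i =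
        ∑ i ∈ Finset.range m, f (i + 1) := by
      intro m f
      rw [hI, Finset.sum_image (by intro a _ b _ h; simpa using h)]
    rw [hS] at hRH hmod
    obtain ⟨f, hf⟩ : ∃ f : ℕ → ℕ, ∀ i, d.getD i 0 = f i := ⟨_, fun _ => rfl⟩
    have hd : d = (List.range (N - 1)).map f := by
      apply List.ext_getElem
      · simp [hlen]
      · intro i a b
        simp [← hf, a]
    simp only [dGet, Nat.add_sub_cancel, hf] at hRH hmod
    subst hd
    clear hf hlen hS hI
    interval_cases N <;>
      norm_num [Finset.sum_range_succ] at hRH hmod <;>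
      simp [List.range_succ] <;>
      rcases hgN with rfl | ⟨rfl, h⟩ <;> push_cast at hRH <;>
      first
      | omega
      | (have h0 : f 0 = 0 := by clear hmod; omega
         have h1 : f 1 = 0 := by clear hmod; omega
         have h2 : f 2 = 0 := by clear hmod; omega
         have h4 : f 4 = 0 := by clear hmod; omega
         have h5 : f 5 = 0 := by clear hmod; omega
         have h6 : f 6 = 0 := by clear hmod; omega
         simp only [h0, h1, h2, h4, h5, h6] at hRH hmod
         omega)
  · rintro (h | h | h | h) <;> simp only [Prod.mk.injEq] at h <;> obtain ⟨rfl, rfl, rfl⟩ := h <;>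
      exact ⟨by unfold IsAdmissible; decide, by norm_num⟩
end

section
/- There are exactly 43 distinct 3-admissible data A = (0, N; d_1, …, d_{N−1}) with base genus g' = 0 satisfying the connectedness condition k(A) = 1, where k(A) is the greatest common divisor of N together with all indices i ∈ {1,…,N−1} such that d_i ≠ 0. -/
open Finset

/-- Weighted sum of the entries of a list, with positions starting at `i`. -/
def wsum (f : ℕ → ℕ) : ℕ → List ℕ → ℕ
  | _, [] => 0
  | i, a :: l => a * f i + wsum f (i + 1) l

/-- The gcd of `N` and all positions of nonzero entries, positions starting at `i`. -/
def gsup (N : ℕ) : ℕ → List ℕ → ℕ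
  | _, [] => N
  | i, a :: l => if a = 0 then gsup N (i + 1) l else Nat.gcd i (gsup N (i + 1) l)

/-- All lists of length `k` with weighted sum `t`, positions starting at `i`. -/
def enumL (N : ℕ) : ℕ → ℕ → ℕ → List (List ℕ)
  | 0, _, t => if t = 0 then [[]] else []
  | k + 1, i, t =>
    (List.range (t / (N - Nat.gcd i N) + 1)).flatMap
      (fun a => (enumL N k (i + 1) (t - a * (N - Nat.gcd i N))).map (fun l => a :: l))

/-- Decidable form of the conditions. -/
def chk (N : ℕ) (l : List ℕ) : Bool :=
  Nat.beq (wsum id 1 l % N) 0 && Nat.beq (gsup N 1 l) 1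

/-- The full list of solutions. -/
def sols (N : ℕ) : List (List ℕ) := (enumL N (N - 1) 1 (2 * N + 4)).filter (chk N)

def allSols : List (ℕ × List ℕ) :=
  ((List.range 23).map (fun m => m + 2)).flatMap (fun N => (sols N).map (fun l => (N, l)))

lemma wsum_eq (f : ℕ → ℕ) (l : List ℕ) (i : ℕ) :
    wsum f i l = ∑ j ∈ Finset.range l.length, l.getD j 0 * f (i + j) := by
  induction l generalizing i with
  | nil => simp [wsum]
  | cons a l ih =>
    rw [wsum, ih, List.length_cons, Finset.sum_range_succ', add_comm]
    congr 1
    apply Finset.sum_congr rfl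
    intro j _
    simp [add_assoc, add_comm 1 j]

lemma dvd_gsup (N : ℕ) (l : List ℕ) (i c : ℕ) :
    c ∣ gsup N i l ↔ c ∣ N ∧ ∀ j < l.length, l.getD j 0 ≠ 0 → c ∣ i + j := by
  induction l generalizing i with
  | nil => simp [gsup]
  | cons a l ih =>
    have key : (∀ j < (a :: l).length, (a :: l).getD j 0 ≠ 0 → c ∣ i + j) ↔
        (a ≠ 0 → c ∣ i) ∧ (∀ j < l.length, l.getD j 0 ≠ 0 → c ∣ (i + 1) + j) := by
      constructor
      · intro h
        refine ⟨fun ha => by simpa using h 0 (by simp) (by simpa using ha), ?_⟩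
        intro j hj hne
        have := h (j + 1) (by simpa using hj) (by simpa using hne)
        have e : i + 1 + j = i + (j + 1) := by ring
        rwa [e]
      · rintro ⟨h0, h⟩ j hj hne
        cases j with
        | zero => simpa using h0 (by simpa using hne)
        | succ j =>
          have := h j (by simpa using hj) (by simpa using hne)
          have e : i + 1 + j = i + (j + 1) := by ring
          rwa [e] at this
    rw [key]
    unfold gsup
    by_cases ha : a = 0
    · simp [ha, ih]
    · simp only [ha, if_false, Nat.dvd_gcd_iff, ih]
      tauto

lemma sum_Icc_eq (N : ℕ) (hN : 1 ≤ N) (f : ℕ → ℕ) : ∑ i ∈ Finset.Icc 1 (N - 1), f i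
    = ∑ j ∈ Finset.range (N - 1), f (1 + j) := by
  have : Finset.Icc 1 (N - 1) = Finset.Ico 1 N := by
    ext x; simp only [Finset.mem_Icc, Finset.mem_Ico]; omega
  rw [this, Finset.sum_Ico_eq_sum_range]

lemma gcd_lt_of (N i : ℕ) (hi : 1 ≤ i) (hN : i < N) : Nat.gcd i N < N :=
  lt_of_le_of_lt (Nat.gcd_le_left N hi) hN

lemma mem_enumL (N k : ℕ) (l : List ℕ) (i t : ℕ) (hi : 1 ≤ i) (hN : i + k = N) :
    l ∈ enumL N k i t ↔ l.length = k ∧ wsum (fun i => N - Nat.gcd i N) i l = t := by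
  induction k generalizing i t l with
  | zero =>
    by_cases h : t = 0
    · subst h
      simp only [enumL, if_true, List.mem_singleton, List.length_eq_zero_iff]
      constructor
      · rintro rfl; simp [wsum]
      · exact fun h => h.1
    · simp only [enumL, h, if_false, List.not_mem_nil, List.length_eq_zero_iff, false_iff]
      rintro ⟨rfl, h2⟩
      exact h (by simpa [wsum] using h2.symm)
  | succ k ih =>
    have hw : 0 < N - Nat.gcd i N := by
      have := gcd_lt_of N i hi (by omega)
      omega
    simp only [enumL, List.mem_flatMap, List.mem_range, List.mem_map]
    constructor
    · rintro ⟨a, ha, l', hl', rfl⟩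
      rw [ih l' (i + 1) _ (by omega) (by omega)] at hl'
      refine ⟨by simp [hl'.1], ?_⟩
      have h1 : a * (N - Nat.gcd i N) ≤ t := by
        rw [← Nat.le_div_iff_mul_le hw]; omega
      simp only [wsum, hl'.2]
      omega
    · rintro ⟨hlen, hs⟩
      cases l with
      | nil => simp at hlen
      | cons a l' =>
        simp only [wsum] at hs
        refine ⟨a, ?_, l', ?_, rfl⟩
        · have : a ≤ t / (N - Nat.gcd i N) := by
            rw [Nat.le_div_iff_mul_le hw]; omega
          omega
        · rw [ih l' (i + 1) _ (by omega) (by omega)]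
          exact ⟨by simpa using hlen, by omega⟩

/-- The multiset of positions, with multiplicities given by the entries. -/
def mset : ℕ → List ℕ → Multiset ℕ
  | _, [] => 0
  | i, a :: l => Multiset.replicate a i + mset (i + 1) l

lemma mset_sum (f : ℕ → ℕ) (l : List ℕ) (i : ℕ) : ((mset i l).map f).sum = wsum f i l := by
  induction l generalizing i with
  | nil => simp [mset, wsum]
  | cons a l ih => simp [mset, wsum, ih]

lemma mset_mem (l : List ℕ) (i x : ℕ) (hx : x ∈ mset i l) : i ≤ x ∧ x < i + l.length := by
  induction l generalizing i with
  | nil => simp [mset] at hx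
  | cons a l ih =>
    rw [mset, Multiset.mem_add] at hx
    rw [List.length_cons]
    rcases hx with hx | hx
    · have := Multiset.eq_of_mem_replicate hx
      omega
    · have := ih _ hx
      omega

lemma mset_gsup (N c : ℕ) (hc : c ∣ N) (l : List ℕ) (i : ℕ) (h : ∀ x ∈ mset i l, c ∣ x) :
    c ∣ gsup N i l := by
  induction l generalizing i with
  | nil => simpa [gsup] using hc
  | cons a l ih =>
    have h2 := ih (i + 1) (fun x hx => h x (by rw [mset, Multiset.mem_add]; exact Or.inr hx))
    unfold gsup
    split_ifs with ha
    · exact h2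
    · refine Nat.dvd_gcd (h i ?_) h2
      rw [mset, Multiset.mem_add]
      exact Or.inl (Multiset.mem_replicate.2 ⟨ha, rfl⟩)

lemma three_aux (N a b c : ℕ) (hN : 25 ≤ N) (hb : b ≤ a) (hc : c ≤ a) (hs : a + b + c + 4 = N)
    (hb0 : 0 < b) (hc0 : 0 < c) (hd : a ∣ N) (hle : a * (b * c) ≤ N) : False := by
  have ha : 7 ≤ a := by omega
  have hbc : b * c ≤ 3 := by
    by_contra hcon
    have : a * 4 ≤ a * (b * c) := Nat.mul_le_mul_left a (by omega)
    omega
  have hb3 : b ≤ 3 := le_trans (Nat.le_mul_of_pos_right b hc0) hbc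
  have hc3 : c ≤ 3 := le_trans (Nat.le_mul_of_pos_left c hb0) hbc
  have h2 : a ∣ b + c + 4 := by
    have e : N = a + (b + c + 4) := by omega
    rw [e] at hd
    exact (Nat.dvd_add_right (dvd_refl a)).1 hd
  have := Nat.le_of_dvd (by omega) h2
  omega

lemma three_case (N x y z : ℕ) (hN : 25 ≤ N) (hx : 0 < x) (hy : 0 < y) (hz : 0 < z)
    (hs : Nat.gcd x N + Nat.gcd y N + Nat.gcd z N + 4 = N) (hd : N ∣ x + y + z)
    (hg : ∀ c, c ∣ N → c ∣ x → c ∣ y → c ∣ z → c = 1) : False := by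
  have hxy : Nat.Coprime (Nat.gcd x N) (Nat.gcd y N) := by
    set c := Nat.gcd (Nat.gcd x N) (Nat.gcd y N) with hc
    have h1 : c ∣ x := (Nat.gcd_dvd_left _ _).trans (Nat.gcd_dvd_left _ _)
    have h2 : c ∣ y := (Nat.gcd_dvd_right _ _).trans (Nat.gcd_dvd_left _ _)
    have h3 : c ∣ N := (Nat.gcd_dvd_right _ _).trans (Nat.gcd_dvd_right _ _)
    exact hg c h3 h1 h2 ((Nat.dvd_add_right (dvd_add h1 h2)).1 (h3.trans hd))
  have hxz : Nat.Coprime (Nat.gcd x N) (Nat.gcd z N) := by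
    set c := Nat.gcd (Nat.gcd x N) (Nat.gcd z N) with hc
    have h1 : c ∣ x := (Nat.gcd_dvd_left _ _).trans (Nat.gcd_dvd_left _ _)
    have h2 : c ∣ z := (Nat.gcd_dvd_right _ _).trans (Nat.gcd_dvd_left _ _)
    have h3 : c ∣ N := (Nat.gcd_dvd_right _ _).trans (Nat.gcd_dvd_right _ _)
    refine hg c h3 h1 ?_ h2
    have e : x + y + z = x + z + y := by ring
    rw [e] at hd
    exact (Nat.dvd_add_right (dvd_add h1 h2)).1 (h3.trans hd)
  have hyz : Nat.Coprime (Nat.gcd y N) (Nat.gcd z N) := by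
    set c := Nat.gcd (Nat.gcd y N) (Nat.gcd z N) with hc
    have h1 : c ∣ y := (Nat.gcd_dvd_left _ _).trans (Nat.gcd_dvd_left _ _)
    have h2 : c ∣ z := (Nat.gcd_dvd_right _ _).trans (Nat.gcd_dvd_left _ _)
    have h3 : c ∣ N := (Nat.gcd_dvd_right _ _).trans (Nat.gcd_dvd_right _ _)
    refine hg c h3 ?_ h1 h2
    have e : x + y + z = y + z + x := by ring
    rw [e] at hd
    exact (Nat.dvd_add_right (dvd_add h1 h2)).1 (h3.trans hd)
  have hax := Nat.gcd_dvd_right x N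
  have hay := Nat.gcd_dvd_right y N
  have haz := Nat.gcd_dvd_right z N
  have px := Nat.gcd_pos_of_pos_left N hx
  have py := Nat.gcd_pos_of_pos_left N hy
  have pz := Nat.gcd_pos_of_pos_left N hz
  generalize Nat.gcd x N = a at *
  generalize Nat.gcd y N = b at *
  generalize Nat.gcd z N = c at *
  have h1 : b * c ∣ N := Nat.Coprime.mul_dvd_of_dvd_of_dvd hyz hay haz
  have h2 : a * (b * c) ∣ N :=
    Nat.Coprime.mul_dvd_of_dvd_of_dvd (Nat.Coprime.mul_right hxy hxz) hax h1
  have h3 := Nat.le_of_dvd (by omega) h2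
  rcases le_total a b with h | h <;> rcases le_total b c with h' | h' <;>
    rcases le_total a c with h'' | h''
  · exact three_aux N c a b hN h'' h' (by omega) px py haz (by linarith [mul_comm c (a * b), mul_assoc a b c])
  · exact three_aux N c a b hN (by omega) h' (by omega) px py haz (by linarith [mul_comm c (a * b), mul_assoc a b c])
  · exact three_aux N b a c hN h h' (by omega) px pz hay (by linarith [mul_left_comm b a c])
  · exact three_aux N b a c hN h h' (by omega) px pz hay (by linarith [mul_left_comm b a c])
  · exact three_aux N c a b hN h'' h' (by omega) px py haz (by linarith [mul_comm c (a * b), mul_assoc a b c])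
  · exact three_aux N a b c hN h h'' (by omega) py pz hax h3
  · exact three_aux N a b c hN h (by omega) (by omega) py pz hax h3
  · exact three_aux N a b c hN h h'' (by omega) py pz hax h3

lemma gcd_half (N x : ℕ) (hx : 0 < x) (hxN : x < N) :
    0 < Nat.gcd x N ∧ (2 * Nat.gcd x N = N ∨ 3 * Nat.gcd x N ≤ N) := by
  have h1 := gcd_lt_of N x hx hxN
  have h2 := Nat.gcd_pos_of_pos_left N hx
  refine ⟨h2, ?_⟩
  obtain ⟨k, hk⟩ := Nat.gcd_dvd_right x N
  generalize Nat.gcd x N = g at *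
  rcases k with _ | _ | _ | k
  · omega
  · omega
  · left; omega
  · right
    rw [hk]
    nlinarith

lemma card_bounds (N : ℕ) (s : Multiset ℕ) (hs : ∀ x ∈ s, 0 < x ∧ x < N) :
    s.card * N ≤ 2 * (s.map (fun i => N - Nat.gcd i N)).sum ∧
    (s.map (fun i => N - Nat.gcd i N)).sum + s.card ≤ s.card * N := by
  induction s using Multiset.induction_on with
  | empty => simp
  | cons a s ih =>
    have h := ih (fun x hx => hs x (Multiset.mem_cons_of_mem hx))
    obtain ⟨h1, h2⟩ := hs a (Multiset.mem_cons_self a s)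
    have h3 := gcd_half N a h1 h2
    simp only [Multiset.card_cons, Multiset.map_cons, Multiset.sum_cons, add_mul, one_mul]
    omega

lemma N_bound (N : ℕ) (l : List ℕ) (hlen : l.length = N - 1)
    (hw : wsum (fun i => N - Nat.gcd i N) 1 l = 2 * N + 4) (hd : N ∣ wsum id 1 l)
    (hg : gsup N 1 l = 1) : N ≤ 24 := by
  by_contra hcon
  have hN : 25 ≤ N := by omega
  rw [← mset_sum] at hw hd
  have hmem : ∀ x ∈ mset 1 l, 0 < x ∧ x < N := by
    intro x hx
    have := mset_mem l 1 x hx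
    omega
  have hgc : ∀ c, c ∣ N → (∀ x ∈ mset 1 l, c ∣ x) → c = 1 := by
    intro c hc h
    have := mset_gsup N c hc l 1 h
    rw [hg] at this
    exact Nat.dvd_one.1 this
  generalize mset 1 l = s at *
  obtain ⟨hb1, hb2⟩ := card_bounds N s hmem
  rw [hw] at hb1 hb2
  have hc4 : s.card ≤ 4 := by
    by_contra h
    have : 5 * N ≤ s.card * N := Nat.mul_le_mul_right N (by omega)
    omega
  have hc3 : 3 ≤ s.card := by
    by_contra h
    have : s.card * N ≤ 2 * N := Nat.mul_le_mul_right N (by omega)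
    omega
  have hcard : s.card = 3 ∨ s.card = 4 := by omega
  rcases hcard with h | h
  · obtain ⟨x, y, z, rfl⟩ := Multiset.card_eq_three.1 h
    simp only [Multiset.insert_eq_cons, Multiset.mem_cons, Multiset.mem_singleton,
      forall_eq_or_imp, forall_eq, Multiset.map_cons, Multiset.map_singleton, Multiset.sum_cons,
      Multiset.sum_singleton, id] at hmem hgc hw hd
    obtain ⟨hx, hy, hz⟩ := hmem
    have gx := gcd_half N x hx.1 hx.2
    have gy := gcd_half N y hy.1 hy.2
    have gz := gcd_half N z hz.1 hz.2
    exact three_case N x y z hN hx.1 hy.1 hz.1 (by omega) (by rwa [add_assoc])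
      (fun c h1 h2 h3 h4 => hgc c h1 ⟨h2, h3, h4⟩)
  · obtain ⟨w, s, rfl⟩ := Multiset.card_pos_iff_exists_mem.1 (by omega : 0 < s.card) |>.imp
      (fun w hw => Multiset.exists_cons_of_mem hw)
    rw [Multiset.card_cons] at h
    obtain ⟨x, y, z, rfl⟩ := Multiset.card_eq_three.1 (by omega : s.card = 3)
    simp only [Multiset.insert_eq_cons, Multiset.mem_cons, Multiset.mem_singleton,
      forall_eq_or_imp, forall_eq, Multiset.map_cons, Multiset.map_singleton, Multiset.sum_cons,
      Multiset.sum_singleton, id] at hmem hw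
    obtain ⟨hw', hx, hy, hz⟩ := hmem
    have gw := gcd_half N w hw'.1 hw'.2
    have gx := gcd_half N x hx.1 hx.2
    have gy := gcd_half N y hy.1 hy.2
    have gz := gcd_half N z hz.1 hz.2
    omega

lemma kOf_eq (N : ℕ) (l : List ℕ) (hN : 2 ≤ N) (hlen : l.length = N - 1) :
    kOf N l = gsup N 1 l := by
  have key : ∀ c, c ∣ kOf N l ↔ c ∣ gsup N 1 l := by
    intro c
    rw [dvd_gsup, kOf, Nat.dvd_gcd_iff, Finset.dvd_gcd_iff]
    refine and_congr_right fun _ => ?_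
    constructor
    · intro h j hj hne
      refine h (1 + j) ?_
      rw [Finset.mem_filter, Finset.mem_Icc]
      refine ⟨by omega, ?_⟩
      simpa [dGet] using hne
    · intro h b hb
      rw [Finset.mem_filter, Finset.mem_Icc] at hb
      have := h (b - 1) (by omega) hb.2
      have e : 1 + (b - 1) = b := by omega
      rwa [e] at this
  exact Nat.dvd_antisymm ((key _).1 dvd_rfl) ((key _).2 dvd_rfl)

lemma wsum_Icc (N : ℕ) (l : List ℕ) (hN : 2 ≤ N) (hlen : l.length = N - 1) (f : ℕ → ℕ) :
    ∑ i ∈ Finset.Icc 1 (N - 1), dGet l i * f i = wsum f 1 l := by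
  rw [sum_Icc_eq N (by omega), wsum_eq, hlen]
  apply Finset.sum_congr rfl
  intro j _
  simp [dGet]

lemma adm_iff (N : ℕ) (l : List ℕ) : (IsAdmissible 3 0 N l ∧ kOf N l = 1) ↔
    2 ≤ N ∧ l.length = N - 1 ∧ wsum (fun i => N - Nat.gcd i N) 1 l = 2 * N + 4 ∧
      N ∣ wsum id 1 l ∧ gsup N 1 l = 1 := by
  unfold IsAdmissible
  by_cases hN : 2 ≤ N
  swap
  · simp [hN]
  by_cases hlen : l.length = N - 1
  swap
  · simp [hlen]
  have h1 : ∑ i ∈ Finset.Icc 1 (N - 1),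
       (dGet l i : ℤ) * (Nat.gcd i N : ℤ) * (((N / Nat.gcd i N : ℕ) : ℤ) - 1)
      = ((wsum (fun i => N - Nat.gcd i N) 1 l : ℕ) : ℤ) := by
    rw [← wsum_Icc N l hN hlen]
    rw [Nat.cast_sum]
    apply Finset.sum_congr rfl
    intro i hi
    rw [Nat.cast_mul]
    have hle : Nat.gcd i N ≤ N := Nat.gcd_le_right i (by omega)
    rw [Nat.cast_sub hle]
    have hm : ((Nat.gcd i N : ℕ) : ℤ) * ((N / Nat.gcd i N : ℕ) : ℤ) = (N : ℤ) := by
      exact_mod_cast Nat.mul_div_cancel' (Nat.gcd_dvd_right i N)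
    rw [mul_assoc, mul_sub, hm, mul_one]
  have h2 : ∑ i ∈ Finset.Icc 1 (N - 1), (i : ℤ) * (dGet l i : ℤ) = ((wsum id 1 l : ℕ) : ℤ) := by
    rw [← wsum_Icc N l hN hlen]
    push_cast
    apply Finset.sum_congr rfl
    intro i hi
    simp [mul_comm]
  rw [h1, h2, kOf_eq N l hN hlen, Int.natCast_dvd_natCast]
  generalize wsum (fun i => N - Nat.gcd i N) 1 l = W
  constructor
  · rintro ⟨⟨_, _, _, h, h'⟩, h''⟩
    exact ⟨hN, hlen, by omega, h', h''⟩
  · rintro ⟨_, _, h, h', h''⟩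
    exact ⟨⟨hN, by omega, hlen, by omega, h'⟩, h''⟩

lemma mem_allSols (N : ℕ) (l : List ℕ) :
    (N, l) ∈ allSols ↔ IsAdmissible 3 0 N l ∧ kOf N l = 1 := by
  rw [adm_iff]
  have h0 : (N, l) ∈ allSols ↔ (2 ≤ N ∧ N ≤ 24) ∧ l ∈ sols N := by
    simp only [allSols, List.mem_flatMap, List.mem_map, List.mem_range, Prod.mk.injEq]
    constructor
    · rintro ⟨_, ⟨m, hm, rfl⟩, l', hl', rfl, rfl⟩
      exact ⟨by omega, hl'⟩
    · rintro ⟨h, hl⟩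
      exact ⟨N, ⟨N - 2, by omega, by omega⟩, l, hl, rfl, rfl⟩
  rw [h0]
  have hchk : chk N l = true ↔ N ∣ wsum id 1 l ∧ gsup N 1 l = 1 := by
    simp only [chk, Bool.and_eq_true, Nat.beq_eq, Nat.dvd_iff_mod_eq_zero]
  constructor
  · rintro ⟨⟨h2, _⟩, hl⟩
    rw [sols, List.mem_filter, mem_enumL N (N - 1) l 1 _ le_rfl (by omega), hchk] at hl
    exact ⟨h2, hl.1.1, hl.1.2, hl.2⟩
  · rintro ⟨h2, hlen, hw, hd, hg⟩
    refine ⟨⟨h2, N_bound N l hlen hw hd hg⟩, ?_⟩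
    rw [sols, List.mem_filter, mem_enumL N (N - 1) l 1 _ le_rfl (by omega), hchk]
    exact ⟨⟨hlen, hw⟩, hd, hg⟩

set_option maxRecDepth 100000 in
lemma allSols_spec : allSols.length = 43 ∧ allSols.Nodup := by
  decide +kernel

/-- There are exactly `43` distinct `3`-admissible data with base genus `0`
satisfying the connectedness condition `k = 1`. -/
theorem genus3_base0_connected_card :
    {A : ℕ × List ℕ | IsAdmissible 3 0 A.1 A.2 ∧ kOf A.1 A.2 = 1}.Finite ∧
    {A : ℕ × List ℕ | IsAdmissible 3 0 A.1 A.2 ∧ kOf A.1 A.2 = 1}.ncard = 43 := by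
  have hset : {A : ℕ × List ℕ | IsAdmissible 3 0 A.1 A.2 ∧ kOf A.1 A.2 = 1}
      = (allSols.toFinset : Set (ℕ × List ℕ)) := by
    ext ⟨N, l⟩
    simp only [Set.mem_ofPred_eq, List.coe_toFinset, mem_allSols]
  rw [hset]
  refine ⟨Finset.finite_toSet _, ?_⟩
  rw [Set.ncard_coe_finset, List.toFinset_card_of_nodup allSols_spec.2, allSols_spec.1]
end

section
/- The 3-admissible data A = (0, N; d_1, …, d_{N−1}) with g' = 0, with k(A) = 1, and with Σ_{i=1}^{N−1} d_i ≥ 4 are exactly the following eleven tuples: (0,2;8), (0,3;4,1), (0,3;1,4), (0,4;4,0,0), (0,4;0,0,4), (0,4;2,3,0), (0,4;0,3,2), (0,4;2,0,2), (0,6;1,0,2,0,1), (0,6;1,0,1,2,0), and (0,6;0,2,1,0,1). -/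
open Finset

/-- The bound on `N`, and the Riemann–Hurwitz equation. -/
theorem bound_N (N : ℕ) (d : List ℕ) (h : IsAdmissible 3 0 N d)
    (h4 : 4 ≤ ∑ i ∈ Finset.Icc 1 (N - 1), dGet d i) :
    N ≤ 24 ∧ (N ≤ 8 ∨ ∑ i ∈ Finset.Icc 1 (N - 1), dGet d i = 4) ∧
    ∑ i ∈ Finset.Icc 1 (N - 1), (dGet d i : ℤ) * ((N : ℤ) - (Nat.gcd i N : ℤ)) = 2 * N + 4 := by
  obtain ⟨hN, -, -, hRH, -⟩ := h
  have hR : ∑ i ∈ Finset.Icc 1 (N - 1), (dGet d i : ℤ) * ((N : ℤ) - (Nat.gcd i N : ℤ))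
      = 2 * N + 4 := by
    have : ∑ i ∈ Finset.Icc 1 (N - 1), (dGet d i : ℤ) * ((N : ℤ) - (Nat.gcd i N : ℤ)) =
      ∑ i ∈ Finset.Icc 1 (N - 1),
       (dGet d i : ℤ) * (Nat.gcd i N : ℤ) * (((N / Nat.gcd i N : ℕ) : ℤ) - 1) := by
      refine Finset.sum_congr rfl fun i _ => ?_
      have h1 : ((Nat.gcd i N : ℕ) : ℤ) * ((N / Nat.gcd i N : ℕ) : ℤ) = N := by
        exact_mod_cast Nat.mul_div_cancel' (Nat.gcd_dvd_right i N)
      linear_combination -(dGet d i : ℤ) * h1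
    rw [this]; push_cast at hRH ⊢; linarith
  have hg : ∀ i ∈ Finset.Icc 1 (N - 1), 2 * Nat.gcd i N = N ∨ 3 * Nat.gcd i N ≤ N := by
    intro i hi
    rw [Finset.mem_Icc] at hi
    obtain ⟨m, hm⟩ := Nat.gcd_dvd_right i N
    have hle : Nat.gcd i N ≤ i := Nat.gcd_le_left _ (by omega)
    generalize Nat.gcd i N = g at hm hle
    rcases m with _ | _ | _ | m
    · omega
    · omega
    · left; omega
    · right; subst hm; nlinarith
  set S := ∑ i ∈ Finset.Icc 1 (N - 1), dGet d i with hS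
  have hSz : ∑ i ∈ Finset.Icc 1 (N - 1), (dGet d i : ℤ) = S := by rw [hS]; push_cast; rfl
  have hE : ∑ i ∈ Finset.Icc 1 (N - 1), (dGet d i : ℤ) * ((N : ℤ) - 2 * (Nat.gcd i N : ℤ))
      = 4 * N + 8 - N * S := by
    have : ∑ i ∈ Finset.Icc 1 (N - 1), (dGet d i : ℤ) * ((N : ℤ) - 2 * (Nat.gcd i N : ℤ)) =
        ∑ i ∈ Finset.Icc 1 (N - 1), (2 * ((dGet d i : ℤ) * ((N : ℤ) - (Nat.gcd i N : ℤ)))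
          - N * (dGet d i : ℤ)) := Finset.sum_congr rfl fun i _ => by ring
    rw [this, Finset.sum_sub_distrib, ← Finset.mul_sum, ← Finset.mul_sum, hR, hSz]; ring
  have hnn : ∀ i ∈ Finset.Icc 1 (N - 1),
      0 ≤ (dGet d i : ℤ) * ((N : ℤ) - 2 * (Nat.gcd i N : ℤ)) := by
    intro i hi
    have := hg i hi
    exact mul_nonneg (by positivity) (by omega)
  have h0 := Finset.sum_nonneg hnn
  rw [hE] at h0
  rcases Nat.lt_or_ge 4 S with h5 | h5
  · have : N ≤ 8 := by
      have h5' : (5 : ℤ) ≤ S := by exact_mod_cast h5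
      have : (N : ℤ) ≤ 8 := by nlinarith
      exact_mod_cast this
    exact ⟨by omega, Or.inl this, hR⟩
  · have hS4 : S = 4 := le_antisymm h5 h4
    refine ⟨?_, Or.inr hS4, hR⟩
    rw [hS4] at hE
    obtain ⟨i, hi, hne⟩ := Finset.exists_ne_zero_of_sum_ne_zero
      (show ∑ i ∈ Finset.Icc 1 (N - 1), (dGet d i : ℤ) * ((N : ℤ) - 2 * (Nat.gcd i N : ℤ)) ≠ 0 by
        rw [hE]; push_cast; omega)
    have hs := Finset.single_le_sum hnn hi
    rw [hE] at hs
    have hd : (1 : ℤ) ≤ dGet d i := by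
      have : dGet d i ≠ 0 := by rintro h; simp [h] at hne
      omega
    have h3 : 3 * Nat.gcd i N ≤ N := by
      rcases hg i hi with h | h
      · exfalso; apply hne
        have : (N : ℤ) - 2 * (Nat.gcd i N : ℤ) = 0 := by omega
        rw [this, mul_zero]
      · exact h
    have h3' : (3 : ℤ) * Nat.gcd i N ≤ N := by exact_mod_cast h3
    push_cast at hs
    have : (N : ℤ) ≤ 24 := by nlinarith
    exact_mod_cast this

/-- If `k = 1` then for each prime `p ∣ N` some index prime to `p` occurs. -/
theorem k_pos (N p : ℕ) (d : List ℕ) (hk : kOf N d = 1) (hp : p ≠ 1) (hpN : p ∣ N) :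
    1 ≤ ∑ i ∈ Finset.Icc 1 (N - 1), if p ∣ i then 0 else dGet d i := by
  by_contra hcon
  have h0 : ∑ i ∈ Finset.Icc 1 (N - 1), (if p ∣ i then 0 else dGet d i) = 0 := by omega
  rw [Finset.sum_eq_zero_iff] at h0
  have : p ∣ kOf N d := by
    refine Nat.dvd_gcd hpN (Finset.dvd_gcd fun i hi => ?_)
    rw [Finset.mem_filter] at hi
    by_contra hpi
    have := h0 i hi.1
    rw [if_neg (show ¬ p ∣ i from hpi)] at this
    exact hi.2 this
  rw [hk] at this
  exact hp (Nat.dvd_one.mp this)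

/-- There are no data with `N = 10`. -/
theorem case_ten (f : ℕ → ℕ)
    (hS : ∑ i ∈ Finset.Icc 1 (10 - 1), f i = 4)
    (hR : ∑ i ∈ Finset.Icc 1 (10 - 1), (f i : ℤ) * (((10 : ℕ) : ℤ) - (Nat.gcd i 10 : ℤ))
      = 2 * ((10 : ℕ) : ℤ) + 4)
    (hD : ((10 : ℕ) : ℤ) ∣ ∑ i ∈ Finset.Icc 1 (10 - 1), ((i : ℕ) : ℤ) * (f i : ℤ)) : False := by
  norm_num [Finset.sum_Icc_succ_top] at hS hR hD
  have h5 : f 5 = 3 := by omega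
  have h2 : f 2 = 0 := by omega
  have h4 : f 4 = 0 := by omega
  have h6 : f 6 = 0 := by omega
  have h8 : f 8 = 0 := by omega
  have h : f 1 + f 3 + f 7 + f 9 = 1 := by omega
  have : f 1 = 1 ∧ f 3 = 0 ∧ f 7 = 0 ∧ f 9 = 0 ∨ f 1 = 0 ∧ f 3 = 1 ∧ f 7 = 0 ∧ f 9 = 0 ∨
    f 1 = 0 ∧ f 3 = 0 ∧ f 7 = 1 ∧ f 9 = 0 ∨ f 1 = 0 ∧ f 3 = 0 ∧ f 7 = 0 ∧ f 9 = 1 := by omega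
  clear hS hR h
  rcases this with h | h | h | h <;> obtain ⟨a, b, c, e⟩ := h <;>
    rw [h2, h4, h5, h6, h8, a, b, c, e] at hD <;> norm_num at hD

set_option maxHeartbeats 4000000 in
/-- No data with `N ≥ 9`. -/
theorem case_large (N : ℕ) (d : List ℕ) (h9 : 9 ≤ N) (h24 : N ≤ 24) (hk : kOf N d = 1)
    (hS : ∑ i ∈ Finset.Icc 1 (N - 1), dGet d i = 4)
    (hR : ∑ i ∈ Finset.Icc 1 (N - 1), (dGet d i : ℤ) * ((N : ℤ) - (Nat.gcd i N : ℤ))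
      = 2 * N + 4)
    (hD : (N : ℤ) ∣ ∑ i ∈ Finset.Icc 1 (N - 1), ((i : ℕ) : ℤ) * (dGet d i : ℤ)) : False := by
  by_cases h10 : N = 10
  · subst h10
    exact case_ten _ hS hR hD
  have k2 := k_pos N 2 d hk (by norm_num)
  have k3 := k_pos N 3 d hk (by norm_num)
  clear hk hD
  interval_cases N <;> norm_num [Finset.sum_Icc_succ_top] at hS hR k2 k3 h10 <;>
    generalize dGet d = f at * <;> omega

/-- The data with `N ≤ 8`. -/
theorem case_small (N : ℕ) (d : List ℕ) (h2 : 2 ≤ N) (h8 : N ≤ 8) (hk : kOf N d = 1)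
    (hl : d.length = N - 1)
    (hS : 4 ≤ ∑ i ∈ Finset.Icc 1 (N - 1), dGet d i)
    (hR : ∑ i ∈ Finset.Icc 1 (N - 1), (dGet d i : ℤ) * ((N : ℤ) - (Nat.gcd i N : ℤ))
      = 2 * N + 4)
    (hD : (N : ℤ) ∣ ∑ i ∈ Finset.Icc 1 (N - 1), ((i : ℕ) : ℤ) * (dGet d i : ℤ)) :
    (N, d) = (2, [8]) ∨ (N, d) = (3, [4, 1]) ∨ (N, d) = (3, [1, 4]) ∨
       (N, d) = (4, [4, 0, 0]) ∨ (N, d) = (4, [0, 0, 4]) ∨ (N, d) = (4, [2, 3, 0]) ∨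
       (N, d) = (4, [0, 3, 2]) ∨ (N, d) = (4, [2, 0, 2]) ∨
       (N, d) = (6, [1, 0, 2, 0, 1]) ∨ (N, d) = (6, [1, 0, 1, 2, 0]) ∨
       (N, d) = (6, [0, 2, 1, 0, 1]) := by
  have k2 := k_pos N 2 d hk (by norm_num)
  have k3 := k_pos N 3 d hk (by norm_num)
  clear hk
  have hx : N = 2 ∨ N = 3 ∨ N = 4 ∨ N = 5 ∨ N = 6 ∨ N = 7 ∨ N = 8 := by omega
  rcases hx with rfl | rfl | rfl | rfl | rfl | rfl | rfl
  · obtain ⟨a, rfl⟩ := List.length_eq_one_iff.mp hl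
    norm_num [Finset.sum_Icc_succ_top, dGet] at hS hR hD k2 k3 ⊢
    omega
  · obtain ⟨a, b, rfl⟩ := List.length_eq_two.mp hl
    norm_num [Finset.sum_Icc_succ_top, dGet] at hS hR hD k2 k3 ⊢
    have : a ≤ 5 := by omega
    interval_cases a <;> omega
  · obtain ⟨a, b, c, rfl⟩ := List.length_eq_three.mp hl
    norm_num [Finset.sum_Icc_succ_top, dGet] at hS hR hD k2 k3 ⊢
    have : a ≤ 4 := by omega
    have : c ≤ 4 := by omega
    interval_cases a <;> interval_cases c <;> omega
  · norm_num [Finset.sum_Icc_succ_top] at hS hR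
    omega
  · match d, hl with
    | [a, b, c, e, f], _ =>
      norm_num [Finset.sum_Icc_succ_top, dGet] at hS hR hD k2 k3 ⊢
      have : a ≤ 3 := by omega
      have : f ≤ 3 := by omega
      have : b ≤ 4 := by omega
      have : e ≤ 4 := by omega
      interval_cases a <;> interval_cases f <;> try omega
      all_goals interval_cases b <;> interval_cases e <;> omega
  · norm_num [Finset.sum_Icc_succ_top] at hS hR
    omega
  · norm_num [Finset.sum_Icc_succ_top] at hS hR k2 k3
    omega

/-- The `3`-admissible data with base genus `0`, `k = 1` and total branch degree at
least `4` are exactly the eleven listed tuples. -/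
theorem genus3_base0_positive_dimensional (N : ℕ) (d : List ℕ) :
    (IsAdmissible 3 0 N d ∧ kOf N d = 1 ∧
        4 ≤ ∑ i ∈ Finset.Icc 1 (N - 1), dGet d i) ↔
      ((N, d) = (2, [8]) ∨ (N, d) = (3, [4, 1]) ∨ (N, d) = (3, [1, 4]) ∨
       (N, d) = (4, [4, 0, 0]) ∨ (N, d) = (4, [0, 0, 4]) ∨ (N, d) = (4, [2, 3, 0]) ∨
       (N, d) = (4, [0, 3, 2]) ∨ (N, d) = (4, [2, 0, 2]) ∨
       (N, d) = (6, [1, 0, 2, 0, 1]) ∨ (N, d) = (6, [1, 0, 1, 2, 0]) ∨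
       (N, d) = (6, [0, 2, 1, 0, 1])) := by
  constructor
  · rintro ⟨h, hk, h4⟩
    obtain ⟨h24, h8, hR⟩ := bound_N N d h h4
    obtain ⟨h2, -, hl, -, hD⟩ := h
    by_cases hN : N ≤ 8
    · exact case_small N d h2 hN hk hl h4 hR hD
    · exact (case_large N d (by omega) h24 hk (h8.resolve_left hN) hR hD).elim
  · rintro (h | h | h | h | h | h | h | h | h | h | h) <;>
      (rw [Prod.mk.injEq] at h; obtain ⟨rfl, rfl⟩ := h
       unfold IsAdmissible
       decide)
end

section
/- There are exactly 32 distinct 3-admissible data A = (0, N; d_1, …, d_{N−1}) with base genus g' = 0, with k(A) = 1, and with Σ_{i=1}^{N−1} d_i = 3; moreover every 3-admissible datum with g' = 0 and k(A) = 1 satisfies Σ_{i=1}^{N−1} d_i ∈ {3, 4, 5, 8}. -/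
open Finset

theorem h_rh {N : ℕ} {i : ℕ} (hi : i ∈ Finset.Icc 1 (N - 1)) (x : ℤ) :
    x * (Nat.gcd i N : ℤ) * (((N / Nat.gcd i N : ℕ) : ℤ) - 1) = x * ((N : ℤ) - Nat.gcd i N) := by
  have h : ((Nat.gcd i N : ℕ) : ℤ) * ((N / Nat.gcd i N : ℕ) : ℤ) = N := by
    exact_mod_cast Nat.mul_div_cancel' (Nat.gcd_dvd_right i N)
  linear_combination x * h

theorem h_rh_sum {N : ℕ} {d : List ℕ} (h : IsAdmissible 3 0 N d) :
    ∑ i ∈ Finset.Icc 1 (N - 1), (dGet d i : ℤ) * ((N : ℤ) - Nat.gcd i N) = 2 * N + 4 := by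
  obtain ⟨_, _, _, h, _⟩ := h
  rw [Finset.sum_congr rfl (fun i hi => h_rh hi _)] at h
  push_cast at h
  linarith

theorem h_two_gcd {N i : ℕ} (hi : i ∈ Finset.Icc 1 (N - 1)) : 2 * Nat.gcd i N ≤ N := by
  rw [Finset.mem_Icc] at hi
  obtain ⟨c, hc⟩ := Nat.gcd_dvd_right i N
  have h1 : Nat.gcd i N ≤ i := Nat.gcd_le_left _ (by omega)
  have h2 : 2 ≤ c := by
    by_contra hh
    have : c = 0 ∨ c = 1 := by omega
    rcases this with rfl | rfl
    · omega
    · omega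
  nlinarith

theorem h_dvd_k {N p : ℕ} {d : List ℕ} (hp : p ∣ N)
    (h : ∀ i ∈ Finset.Icc 1 (N - 1), dGet d i ≠ 0 → p ∣ i) : p ∣ kOf N d := by
  refine Nat.dvd_gcd hp (Finset.dvd_gcd ?_)
  intro i hi
  rw [Finset.mem_filter] at hi
  exact h i hi.1 hi.2

theorem h_part2 (N : ℕ) (d : List ℕ) (h : IsAdmissible 3 0 N d) (hk : kOf N d = 1) :
    (∑ i ∈ Finset.Icc 1 (N - 1), dGet d i) ∈ ({3, 4, 5, 8} : Set ℕ) := by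
  have hs := h_rh_sum h
  have hN := h.1
  obtain ⟨n, hn⟩ : ∃ n, n = ∑ i ∈ Finset.Icc 1 (N - 1), dGet d i := ⟨_, rfl⟩
  have hnz : (n : ℤ) = ∑ i ∈ Finset.Icc 1 (N - 1), (dGet d i : ℤ) := by rw [hn]; push_cast; rfl
  have hup : (2 * N + 4 : ℤ) ≤ n * (N - 1) := by
    rw [← hs, hnz, Finset.sum_mul]
    refine Finset.sum_le_sum fun i hi => mul_le_mul_of_nonneg_left ?_ (by positivity)
    have : 0 < Nat.gcd i N := Nat.gcd_pos_of_pos_right _ (by omega)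
    omega
  have hlo : (n * N : ℤ) ≤ 2 * (2 * N + 4) := by
    rw [← hs, hnz, Finset.sum_mul, Finset.mul_sum]
    refine Finset.sum_le_sum fun i hi => ?_
    have := h_two_gcd hi
    have h3 : (N : ℤ) ≤ 2 * (N - Nat.gcd i N) := by omega
    nlinarith [Int.natCast_nonneg (dGet d i)]
  rw [← hn]
  have hN' : (2 : ℤ) ≤ N := by exact_mod_cast hN
  have h3 : 3 ≤ n := by
    by_contra hh
    have : (n : ℤ) ≤ 2 := by omega
    nlinarith
  have h8 : n ≤ 8 := by
    by_contra hh
    have : (9 : ℤ) ≤ n := by omega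
    nlinarith
  have h7 : n ≠ 7 := by rintro rfl; push_cast at *; omega
  have h6 : n ≠ 6 := by
    rintro rfl
    have : N = 3 ∨ N = 4 := by push_cast at *; omega
    rcases this with rfl | rfl
    · have e : Finset.Icc 1 (3 - 1) = {1, 2} := by decide
      rw [e] at hs hn
      simp at hs hn
      omega
    · have e : Finset.Icc 1 (4 - 1) = {1, 2, 3} := by decide
      rw [e] at hs hn
      simp at hs hn
      have : 2 ∣ kOf 4 d := by
        refine h_dvd_k (by norm_num) ?_
        rw [e]
        simp
        omega
      rw [hk] at this
      omega
  simp
  omega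

/-- The datum attached to three indices. -/
def datum (q : ℕ × ℕ × ℕ × ℕ) : ℕ × List ℕ :=
  (q.1, (List.range (q.1 - 1)).map fun t =>
    (if q.2.1 = t + 1 then 1 else 0) + (if q.2.2.1 = t + 1 then 1 else 0) +
      (if q.2.2.2 = t + 1 then 1 else 0))

/-- The arithmetic conditions on three indices. -/
def good (q : ℕ × ℕ × ℕ × ℕ) : Bool :=
  (q.2.1 + q.2.2.1 + q.2.2.2) % q.1 == 0 &&
  Nat.gcd q.2.1 q.1 + Nat.gcd q.2.2.1 q.1 + Nat.gcd q.2.2.2 q.1 + 4 == q.1 &&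
  Nat.gcd (Nat.gcd q.1 q.2.1) (Nat.gcd q.2.2.1 q.2.2.2) == 1

/-- All candidate data, without repetition. -/
def cands : List (ℕ × List ℕ) :=
  (((List.range 15).flatMap fun N => (List.range N).flatMap fun i => (List.range N).flatMap fun j =>
    (List.range N).filterMap fun k =>
      if 2 ≤ N ∧ 1 ≤ i ∧ i ≤ j ∧ j ≤ k ∧ good (N, i, j, k) = true then
        some (datum (N, i, j, k)) else none))

theorem cands_nodup : cands.Nodup := by decide +kernel

theorem cands_length : cands.length = 32 := by decide +kernel

/-- The property being counted. -/
def Prp (A : ℕ × List ℕ) : Prop := IsAdmissible 3 0 A.1 A.2 ∧ kOf A.1 A.2 = 1 ∧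
        ∑ i ∈ Finset.Icc 1 (A.1 - 1), dGet A.2 i = 3

instance : DecidablePred Prp := fun A => by
  unfold Prp IsAdmissible
  infer_instance

theorem cands_prp : ∀ A ∈ cands, Prp A := by decide +kernel

theorem h_bound1 {a N : ℕ} (h : a + 6 = N) (hd : a ∣ N) : N ≤ 14 := by
  have : a ∣ 6 := by
    rw [← h] at hd
    exact (Nat.dvd_add_right (dvd_refl a)).1 hd
  have := Nat.le_of_dvd (by norm_num) this
  omega

theorem h_bound2 {a b c : ℕ} (ha : 2 ≤ a) (hb : 2 ≤ b) (hc : 1 ≤ c)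
    (h : a * b * c ≤ a + b + c + 4) : a + b + c ≤ 10 := by
  obtain ⟨x, rfl⟩ := Nat.exists_eq_add_of_le ha
  obtain ⟨y, rfl⟩ := Nat.exists_eq_add_of_le hb
  obtain ⟨z, rfl⟩ := Nat.exists_eq_add_of_le hc
  have hz : z ≤ 5 := by nlinarith [Nat.zero_le (x*y*z), Nat.zero_le (x*y), Nat.zero_le (x*z), Nat.zero_le (y*z)]
  have hx : x ≤ 5 := by nlinarith [Nat.zero_le (x*y*z), Nat.zero_le (x*y), Nat.zero_le (x*z), Nat.zero_le (y*z)]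
  interval_cases z <;> interval_cases x <;> omega

theorem h_bound {N i j k : ℕ} (hN : 2 ≤ N) (hs : N ∣ i + j + k)
    (hg : Nat.gcd i N + Nat.gcd j N + Nat.gcd k N + 4 = N)
    (h1 : ∀ p, p ∣ N → p ∣ i → p ∣ j → p ∣ k → p = 1) : N ≤ 14 := by
  have hi := Nat.gcd_dvd_left i N
  have hj := Nat.gcd_dvd_left j N
  have hk := Nat.gcd_dvd_left k N
  have hi' := Nat.gcd_dvd_right i N
  have hj' := Nat.gcd_dvd_right j N
  have hk' := Nat.gcd_dvd_right k N
  have pi : 0 < Nat.gcd i N := Nat.gcd_pos_of_pos_right _ (by omega)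
  have pj : 0 < Nat.gcd j N := Nat.gcd_pos_of_pos_right _ (by omega)
  have pk : 0 < Nat.gcd k N := Nat.gcd_pos_of_pos_right _ (by omega)
  generalize Nat.gcd i N = a at *
  generalize Nat.gcd j N = b at *
  generalize Nat.gcd k N = c at *
  have cab : Nat.Coprime a b := by
    have ga := Nat.gcd_dvd_left a b
    have gb := Nat.gcd_dvd_right a b
    refine h1 _ (ga.trans hi') (ga.trans hi) (gb.trans hj) ?_
    exact (Nat.dvd_add_right ((ga.trans hi).add (gb.trans hj))).1 ((ga.trans hi').trans hs)
  have cac : Nat.Coprime a c := by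
    have ga := Nat.gcd_dvd_left a c
    have gb := Nat.gcd_dvd_right a c
    refine h1 _ (ga.trans hi') (ga.trans hi) ?_ (gb.trans hk)
    refine (Nat.dvd_add_right ((ga.trans hi).add (gb.trans hk))).1
      (((ga.trans hi').trans hs).trans (dvd_of_eq (by ring)))
  have cbc : Nat.Coprime b c := by
    have ga := Nat.gcd_dvd_left b c
    have gb := Nat.gcd_dvd_right b c
    refine h1 _ (ga.trans hj') ?_ (ga.trans hj) (gb.trans hk)
    refine (Nat.dvd_add_right ((ga.trans hj).add (gb.trans hk))).1
      (((ga.trans hj').trans hs).trans (dvd_of_eq (by ring)))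
  have hd : a * b * c ∣ N :=
    (Nat.Coprime.mul_left cac cbc).mul_dvd_of_dvd_of_dvd (cab.mul_dvd_of_dvd_of_dvd hi' hj') hk'
  have hle := Nat.le_of_dvd (by omega) hd
  by_cases a1 : a = 1
  · by_cases b1 : b = 1
    · exact h_bound1 (by omega) hk'
    · by_cases c1 : c = 1
      · exact h_bound1 (by omega) hj'
      · have := @h_bound2 b c a (by omega) (by omega) (by omega) (by
          rw [show b * c * a = a * b * c by ring]; omega)
        omega
  · by_cases b1 : b = 1
    · by_cases c1 : c = 1
      · exact h_bound1 (by omega) hi'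
      · have := @h_bound2 a c b (by omega) (by omega) (by omega) (by
          rw [show a * c * b = a * b * c by ring]; omega)
        omega
    · have := @h_bound2 a b c (by omega) (by omega) (by omega) (by omega)
      omega

theorem exists_triple (s : Finset ℕ) (f : ℕ → ℕ) (h : ∑ i ∈ s, f i = 3) :
    ∃ i j k, i ∈ s ∧ j ∈ s ∧ k ∈ s ∧ i ≤ j ∧ j ≤ k ∧
      ∀ t ∈ s, f t = (if i = t then 1 else 0) + (if j = t then 1 else 0) +
        (if k = t then 1 else 0) := by
  obtain ⟨m, hm⟩ : ∃ m : Multiset ℕ, m = ∑ i ∈ s, Multiset.replicate (f i) i := ⟨_, rfl⟩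
  have hc : m.card = 3 := by rw [hm, Multiset.card_sum]; simpa using h
  have hcount : ∀ t, m.count t = if t ∈ s then f t else 0 := by
    intro t
    rw [hm, Multiset.count_sum']
    simp [Multiset.count_replicate]
  have hms : ∀ t ∈ m, t ∈ s := by
    intro t ht
    by_contra hh
    have := hcount t
    rw [if_neg hh] at this
    exact (Multiset.count_eq_zero.1 this) ht
  have hl : (m.sort (· ≤ ·)).length = 3 := by rw [Multiset.length_sort, hc]
  have hsort := Multiset.pairwise_sort m (· ≤ ·)
  have heq := Multiset.sort_eq m (· ≤ ·)
  obtain ⟨i, j, k, hijk⟩ := List.length_eq_three.1 hl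
  rw [hijk] at hsort heq
  have h1 : i ∈ m := by rw [← heq]; simp
  have h2 : j ∈ m := by rw [← heq]; simp
  have h3 : k ∈ m := by rw [← heq]; simp
  simp at hsort
  refine ⟨i, j, k, hms _ h1, hms _ h2, hms _ h3, hsort.1.1, hsort.2, ?_⟩
  intro t ht
  have := hcount t
  rw [if_pos ht, ← heq] at this
  rw [← this]
  simp [List.count_cons]
  ring

theorem sum_triple (s : Finset ℕ) (f : ℕ → ℕ) (i j k : ℕ) (hi : i ∈ s) (hj : j ∈ s) (hk : k ∈ s)
    (hf : ∀ t ∈ s, f t = (if i = t then 1 else 0) + (if j = t then 1 else 0) +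
        (if k = t then 1 else 0)) (w : ℕ → ℤ) :
    ∑ t ∈ s, (f t : ℤ) * w t = w i + w j + w k := by
  rw [Finset.sum_congr rfl (fun t ht => by rw [hf t ht])]
  push_cast
  simp [add_mul, Finset.sum_add_distrib, hi, hj, hk]

theorem prp_cands (A : ℕ × List ℕ) (h : Prp A) : A ∈ cands := by
  obtain ⟨N, d⟩ := A
  obtain ⟨ha, hk1, h3⟩ := h
  simp only at ha hk1 h3
  obtain ⟨i, j, k, hi, hj, hk, hij, hjk, hf⟩ := exists_triple _ _ h3
  have hrh := h_rh_sum ha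
  rw [sum_triple _ _ i j k hi hj hk hf] at hrh
  obtain ⟨hN, _, hlen, _, hdvd⟩ := ha
  rw [Finset.sum_congr rfl (fun t _ => mul_comm _ _),
    sum_triple _ _ i j k hi hj hk hf (fun t => (t : ℤ))] at hdvd
  have hdvd' : N ∣ i + j + k := by exact_mod_cast hdvd
  have hg : Nat.gcd i N + Nat.gcd j N + Nat.gcd k N + 4 = N := by omega
  have h1 : ∀ p, p ∣ N → p ∣ i → p ∣ j → p ∣ k → p = 1 := by
    intro p hp hpi hpj hpk
    refine Nat.dvd_one.1 (hk1 ▸ h_dvd_k hp ?_)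
    intro t ht hne
    rw [hf t ht] at hne
    by_cases e1 : i = t
    · exact e1 ▸ hpi
    by_cases e2 : j = t
    · exact e2 ▸ hpj
    by_cases e3 : k = t
    · exact e3 ▸ hpk
    simp [e1, e2, e3] at hne
  have hN14 := h_bound hN hdvd' hg h1
  have hd : (N, d) = datum (N, i, j, k) := by
    unfold datum
    simp only [Prod.mk.injEq, true_and]
    apply List.ext_getElem
    · simp [hlen]
    · intro t ht1 ht2
      have := hf (t + 1) (by rw [Finset.mem_Icc]; omega)
      simp only [List.getElem_map, List.getElem_range]
      rw [← this]
      simp [dGet, ht1]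
  have hgood : good (N, i, j, k) = true := by
    simp only [good, Bool.and_eq_true, beq_iff_eq]
    refine ⟨⟨Nat.mod_eq_zero_of_dvd hdvd', hg⟩, ?_⟩
    have l := Nat.gcd_dvd_left (Nat.gcd N i) (Nat.gcd j k)
    have r := Nat.gcd_dvd_right (Nat.gcd N i) (Nat.gcd j k)
    exact h1 _ (l.trans (Nat.gcd_dvd_left _ _)) (l.trans (Nat.gcd_dvd_right _ _))
      (r.trans (Nat.gcd_dvd_left _ _)) (r.trans (Nat.gcd_dvd_right _ _))
  rw [Finset.mem_Icc] at hi hj hk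
  unfold cands
  simp only [List.mem_flatMap, List.mem_filterMap, List.mem_range]
  refine ⟨N, by omega, i, by omega, j, by omega, k, by omega, ?_⟩
  rw [if_pos ⟨hN, hi.1, hij, hjk, hgood⟩, hd]

/-- There are exactly `32` distinct `3`-admissible data with base genus `0`, `k = 1`
and total branch degree `3`; moreover every `3`-admissible datum with base genus `0`
and `k = 1` has total branch degree in `{3, 4, 5, 8}`. -/
theorem genus3_base0_zero_dimensional :
    ({A : ℕ × List ℕ | IsAdmissible 3 0 A.1 A.2 ∧ kOf A.1 A.2 = 1 ∧
        ∑ i ∈ Finset.Icc 1 (A.1 - 1), dGet A.2 i = 3}.Finite ∧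
     {A : ℕ × List ℕ | IsAdmissible 3 0 A.1 A.2 ∧ kOf A.1 A.2 = 1 ∧
        ∑ i ∈ Finset.Icc 1 (A.1 - 1), dGet A.2 i = 3}.ncard = 32) ∧
    ∀ N : ℕ, ∀ d : List ℕ, IsAdmissible 3 0 N d → kOf N d = 1 →
      (∑ i ∈ Finset.Icc 1 (N - 1), dGet d i) ∈ ({3, 4, 5, 8} : Set ℕ) := by
  have hset : {A : ℕ × List ℕ | IsAdmissible 3 0 A.1 A.2 ∧ kOf A.1 A.2 = 1 ∧
        ∑ i ∈ Finset.Icc 1 (A.1 - 1), dGet A.2 i = 3} = (cands.toFinset : Set (ℕ × List ℕ)) := by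
    ext A
    simp only [List.coe_toFinset, Set.mem_ofPred_eq]
    exact ⟨prp_cands A, cands_prp A⟩
  refine ⟨?_, h_part2⟩
  rw [hset]
  refine ⟨Finset.finite_toSet _, ?_⟩
  rw [Set.ncard_coe_finset, List.toFinset_card_of_nodup cands_nodup, cands_length]
end

section
/- Every 3-admissible datum A = (0, N; d_1, …, d_{N−1}) with base genus g' = 0 and with k(A) = 1 has N ∈ {2, 3, 4, 6, 7, 8, 9, 12, 14}; in particular N ≤ 14, and the values N = 5, 10, 11, 13 do not occur. -/
open Finset

/-- Three branch points, ordered version. -/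
lemma three_ordered (N a b c : ℕ) (ha : 1 ≤ a) (hab : a ≤ b) (hbc : b ≤ c)
    (h1 : a ∣ N) (h2 : b ∣ N) (h3 : c ∣ N) (cab : Nat.Coprime a b) (cac : Nat.Coprime a c)
    (cbc : Nat.Coprime b c) (hs : a + b + c + 4 = N) :
    N = 7 ∨ N = 8 ∨ N = 9 ∨ N = 12 ∨ N = 14 := by
  have hbcN : b * c ∣ N := cbc.mul_dvd_of_dvd_of_dvd h2 h3
  have habc : a * (b * c) ∣ N := (Nat.Coprime.mul_right cab cac).mul_dvd_of_dvd_of_dvd h1 hbcN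
  have hle := Nat.le_of_dvd (by omega) habc
  have ha1 : a = 1 := by
    by_contra hne
    have ha2 : 2 ≤ a := by omega
    have hb3 : 3 ≤ b := by
      by_contra hb
      have e1 : a = 2 := by omega
      have e2 : b = 2 := by omega
      subst e1 e2
      norm_num at cab
    have : 2 * (3 * c) ≤ a * (b * c) := Nat.mul_le_mul ha2 (Nat.mul_le_mul_right c hb3)
    omega
  subst ha1
  have hb : b = 1 ∨ b = 2 ∨ b = 3 ∨ 4 ≤ b := by omega
  rcases hb with rfl | rfl | rfl | hb
  · have h6 : c ∣ 6 := by
      have : N = c + 6 := by omega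
      rw [this] at h3
      exact (Nat.dvd_add_right (dvd_refl c)).1 h3
    have := Nat.le_of_dvd (by norm_num) h6
    interval_cases c <;> omega
  · have h6 : c ∣ 7 := by
      have : N = c + 7 := by omega
      rw [this] at h3
      exact (Nat.dvd_add_right (dvd_refl c)).1 h3
    have := Nat.le_of_dvd (by norm_num) h6
    interval_cases c <;> omega
  · have : c ≤ 4 := by omega
    interval_cases c
    · norm_num at cbc
    · omega
  · have : 4 * c ≤ b * c := Nat.mul_le_mul_right c hb
    omega

/-- Three branch points. -/
lemma three_points (N a b c : ℕ) (ha : 1 ≤ a) (hb : 1 ≤ b) (hc : 1 ≤ c)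
    (h1 : a ∣ N) (h2 : b ∣ N) (h3 : c ∣ N) (cab : Nat.Coprime a b) (cac : Nat.Coprime a c)
    (cbc : Nat.Coprime b c) (hs : a + b + c + 4 = N) :
    N = 7 ∨ N = 8 ∨ N = 9 ∨ N = 12 ∨ N = 14 := by
  rcases le_total a b with hab | hab <;> rcases le_total b c with hbc | hbc <;>
    rcases le_total a c with hac | hac
  · exact three_ordered N a b c ha hab hbc h1 h2 h3 cab cac cbc hs
  · exact three_ordered N a b c ha hab hbc h1 h2 h3 cab cac cbc hs
  · exact three_ordered N a c b ha hac hbc h1 h3 h2 cac cab cbc.symm (by omega)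
  · exact three_ordered N c a b hc hac hab h3 h1 h2 cac.symm cbc.symm cab (by omega)
  · exact three_ordered N b a c hb hab hac h2 h1 h3 cab.symm cbc cac (by omega)
  · exact three_ordered N b c a hb hbc hac h2 h3 h1 cbc cab.symm cac.symm (by omega)
  · exact three_ordered N c b a hc hbc hab h3 h2 h1 cbc.symm cac.symm cab.symm (by omega)
  · exact three_ordered N c b a hc hbc hab h3 h2 h1 cbc.symm cac.symm cab.symm (by omega)

lemma half_or_third (N e : ℕ) (he : e ∣ N) (hlt : e < N) : 2 * e = N ∨ 3 * e ≤ N := by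
  obtain ⟨q, rfl⟩ := he
  have hq : q = 0 ∨ q = 1 ∨ q = 2 ∨ 3 ≤ q := by omega
  rcases hq with rfl | rfl | rfl | hq
  · omega
  · omega
  · left; ring
  · right; rw [mul_comm]; exact Nat.mul_le_mul_left e hq

lemma dvd_ten (e : ℕ) (he : e ∣ 10) (hlt : e < 10) : e = 1 ∨ e = 2 ∨ e = 5 := by
  interval_cases e <;> omega

/-- Four branch points. -/
lemma four_points (N a b c d : ℕ) (ha : a ∣ N) (hb : b ∣ N) (hc : c ∣ N) (hd : d ∣ N)
    (la : a < N) (lb : b < N) (lc : c < N) (ld : d < N)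
    (t1 : b = c → c = d → b = 1) (t2 : a = c → c = d → a = 1)
    (t3 : a = b → b = d → a = 1) (t4 : a = b → b = c → a = 1)
    (hs : a + b + c + d + 4 = 2 * N) :
    N ≤ 12 ∧ N ≠ 10 := by
  constructor
  · have := half_or_third N a ha la
    have := half_or_third N b hb lb
    have := half_or_third N c hc lc
    have := half_or_third N d hd ld
    omega
  · rintro rfl
    have := dvd_ten a ha la
    have := dvd_ten b hb lb
    have := dvd_ten c hc lc
    have := dvd_ten d hd ld
    omega

lemma main_multiset (N : ℕ) (hN : 2 ≤ N) (S : Multiset ℕ) (hS : ∀ x ∈ S, 1 ≤ x ∧ x < N)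
    (hsum : (S.map (fun x => N - Nat.gcd x N)).sum = 2 * N + 4) (hdvd : N ∣ S.sum)
    (hk : ∀ p, p ∣ N → (∀ x ∈ S, p ∣ x) → p = 1) :
    (N ≤ 9 ∨ N = 12 ∨ N = 14) ∧ N ≠ 5 := by
  have hg : ∀ x, 1 ≤ x ∧ x < N → Nat.gcd x N < N ∧ 1 ≤ Nat.gcd x N := fun x hx =>
    ⟨lt_of_le_of_lt (Nat.gcd_le_left N hx.1) hx.2, Nat.gcd_pos_of_pos_left N hx.1⟩
  have hN5 : N ≠ 5 := by
    rintro rfl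
    have : ∀ y ∈ S.map (fun x => 5 - Nat.gcd x 5), y = 4 := by
      intro y hy
      obtain ⟨x, hx, rfl⟩ := Multiset.mem_map.1 hy
      obtain ⟨h1, h2⟩ := hS x hx
      interval_cases x <;> rfl
    rw [Multiset.eq_replicate_card.2 this] at hsum
    simp at hsum
    omega
  refine ⟨?_, hN5⟩
  have hlow : S.card * N ≤ 2 * (2 * N + 4) := by
    have : ∀ y ∈ S.map (fun x => 2 * (N - Nat.gcd x N)), N ≤ y := by
      intro y hy
      obtain ⟨x, hx, rfl⟩ := Multiset.mem_map.1 hy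
      have := hg x (hS x hx)
      have := half_or_third N _ (Nat.gcd_dvd_right x N) this.1
      omega
    have := Multiset.card_nsmul_le_sum this
    rw [Multiset.sum_map_mul_left, hsum] at this
    simpa using this
  have hup : 2 * N + 4 ≤ S.card * (N - 1) := by
    have : ∀ y ∈ S.map (fun x => (N - Nat.gcd x N)), y ≤ N - 1 := by
      intro y hy
      obtain ⟨x, hx, rfl⟩ := Multiset.mem_map.1 hy
      have := hg x (hS x hx)
      omega
    have := Multiset.sum_le_card_nsmul _ _ this
    rw [hsum] at this
    simpa using this
  have hc : S.card ≤ 2 ∨ S.card = 3 ∨ S.card = 4 ∨ 5 ≤ S.card := by omega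
  rcases hc with hc | hc | hc | hc
  · have := Nat.mul_le_mul_right (N - 1) hc
    omega
  · obtain ⟨a, b, c, rfl⟩ := Multiset.card_eq_three.1 hc
    simp at hS hsum hdvd hk
    obtain ⟨sa, sb, sc⟩ := hS
    have ga := hg a sa
    have gb := hg b sb
    have gc := hg c sc
    have key : ∀ x y z, N ∣ x + (y + z) →
        (∀ p, p ∣ N → p ∣ x → p ∣ y → p ∣ z → p = 1) →
        Nat.Coprime (Nat.gcd x N) (Nat.gcd y N) := by
      intro x y z hd hp
      have hpN := (Nat.gcd_dvd_left (Nat.gcd x N) (Nat.gcd y N)).trans (Nat.gcd_dvd_right x N)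
      have hpx := (Nat.gcd_dvd_left (Nat.gcd x N) (Nat.gcd y N)).trans (Nat.gcd_dvd_left x N)
      have hpy := (Nat.gcd_dvd_right (Nat.gcd x N) (Nat.gcd y N)).trans (Nat.gcd_dvd_left y N)
      refine hp _ hpN hpx hpy ?_
      exact (Nat.dvd_add_right hpy).1 ((Nat.dvd_add_right hpx).1 (hpN.trans hd))
    have := three_points N (Nat.gcd a N) (Nat.gcd b N) (Nat.gcd c N) ga.2 gb.2 gc.2
      (Nat.gcd_dvd_right _ _) (Nat.gcd_dvd_right _ _) (Nat.gcd_dvd_right _ _)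
      (key a b c hdvd fun p h1 h2 h3 h4 => hk p h1 h2 h3 h4)
      (key a c b (by rwa [add_comm c b]) fun p h1 h2 h3 h4 => hk p h1 h2 h4 h3)
      (key b c a (by convert hdvd using 1; ring) fun p h1 h2 h3 h4 => hk p h1 h4 h2 h3)
      (by omega)
    omega
  · obtain ⟨a, T, rfl⟩ := (by
      obtain ⟨a, ha⟩ := Multiset.card_pos_iff_exists_mem.1 (show 0 < S.card by omega)
      obtain ⟨T, hT⟩ := Multiset.exists_cons_of_mem ha
      exact ⟨a, T, hT⟩ : ∃ a T, S = a ::ₘ T)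
    have hT : T.card = 3 := by simpa using hc
    obtain ⟨b, c, d, rfl⟩ := Multiset.card_eq_three.1 hT
    simp at hS hsum hdvd hk
    obtain ⟨sa, sb, sc, sd⟩ := hS
    have ga := hg a sa
    have gb := hg b sb
    have gc := hg c sc
    have gd := hg d sd
    have key : ∀ x y z w, N ∣ x + (y + (z + w)) →
        (∀ p, p ∣ N → p ∣ x → p ∣ y → p ∣ z → p ∣ w → p = 1) →
        Nat.gcd x N = Nat.gcd y N → Nat.gcd y N = Nat.gcd z N → Nat.gcd x N = 1 := by
      intro x y z w hd hp e1 e2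
      have hpN := Nat.gcd_dvd_right x N
      have hpx := Nat.gcd_dvd_left x N
      have hpy : Nat.gcd x N ∣ y := e1 ▸ Nat.gcd_dvd_left y N
      have hpz : Nat.gcd x N ∣ z := (e1.trans e2) ▸ Nat.gcd_dvd_left z N
      refine hp _ hpN hpx hpy hpz ?_
      exact (Nat.dvd_add_right hpz).1 ((Nat.dvd_add_right hpy).1
        ((Nat.dvd_add_right hpx).1 (hpN.trans hd)))
    have := four_points N (Nat.gcd a N) (Nat.gcd b N) (Nat.gcd c N) (Nat.gcd d N)
      (Nat.gcd_dvd_right _ _) (Nat.gcd_dvd_right _ _) (Nat.gcd_dvd_right _ _)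
      (Nat.gcd_dvd_right _ _) ga.1 gb.1 gc.1 gd.1
      (key b c d a (by convert hdvd using 1; ring) fun p h1 h2 h3 h4 h5 => hk p h1 h5 h2 h3 h4)
      (key a c d b (by convert hdvd using 1; ring) fun p h1 h2 h3 h4 h5 => hk p h1 h2 h5 h3 h4)
      (key a b d c (by convert hdvd using 1; ring) fun p h1 h2 h3 h4 h5 => hk p h1 h2 h3 h5 h4)
      (key a b c d hdvd fun p h1 h2 h3 h4 h5 => hk p h1 h2 h3 h4 h5)
      (by omega)
    have h11 : N ≠ 11 := by
      rintro rfl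
      have : ∀ x, 1 ≤ x ∧ x < 11 → Nat.gcd x 11 = 1 := by
        rintro x ⟨h1, h2⟩
        interval_cases x <;> rfl
      rw [this a sa, this b sb, this c sc, this d sd] at hsum
      omega
    omega
  · have := Nat.mul_le_mul_right N hc
    omega

/-- Every `3`-admissible datum with base genus `0` and `k = 1` has order
`N ∈ {2, 3, 4, 6, 7, 8, 9, 12, 14}`; in particular `N ≤ 14` and
`N` is none of `5`, `10`, `11`, `13`. -/
theorem genus3_base0_orders (N : ℕ) (d : List ℕ)
    (h : IsAdmissible 3 0 N d) (hk : kOf N d = 1) :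
    N ∈ ({2, 3, 4, 6, 7, 8, 9, 12, 14} : Set ℕ) ∧
    N ≤ 14 ∧ N ≠ 5 ∧ N ≠ 10 ∧ N ≠ 11 ∧ N ≠ 13 := by
  obtain ⟨hN, -, -, hRH, hmod⟩ := h
  have hmem : ∀ x, x ∈ (∑ i ∈ Finset.Icc 1 (N - 1), Multiset.replicate (dGet d i) i) ↔
      (1 ≤ x ∧ x ≤ N - 1) ∧ dGet d x ≠ 0 := by
    intro x
    rw [Multiset.mem_sum]
    constructor
    · rintro ⟨i, hi, hx⟩
      obtain ⟨h0, rfl⟩ := Multiset.mem_replicate.1 hx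
      exact ⟨Finset.mem_Icc.1 hi, h0⟩
    · rintro ⟨h1, h2⟩
      exact ⟨x, Finset.mem_Icc.2 h1, Multiset.mem_replicate.2 ⟨h2, rfl⟩⟩
  have main := main_multiset N hN (∑ i ∈ Finset.Icc 1 (N - 1), Multiset.replicate (dGet d i) i)
    (by
      intro x hx
      have := (hmem x).1 hx
      omega)
    (by
      have e : (Multiset.map (fun x => N - Nat.gcd x N)
          (∑ i ∈ Finset.Icc 1 (N - 1), Multiset.replicate (dGet d i) i)).sum
          = ∑ i ∈ Finset.Icc 1 (N - 1), dGet d i * (N - Nat.gcd i N) := by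
        rw [← Multiset.coe_mapAddMonoidHom, map_sum, ← Multiset.coe_sumAddMonoidHom, map_sum]
        simp
      rw [e]
      zify
      have e2 : ∀ i ∈ Finset.Icc 1 (N - 1),
          (dGet d i : ℤ) * (Nat.gcd i N : ℤ) * (((N / Nat.gcd i N : ℕ) : ℤ) - 1)
          = (dGet d i : ℤ) * ((N - Nat.gcd i N : ℕ) : ℤ) := by
        intro i hi
        have hle : Nat.gcd i N ≤ N := Nat.gcd_le_right i (by omega)
        have hm : (Nat.gcd i N : ℤ) * ((N / Nat.gcd i N : ℕ) : ℤ) = N := by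
          exact_mod_cast Nat.mul_div_cancel' (Nat.gcd_dvd_right i N)
        rw [Nat.cast_sub hle, mul_assoc, mul_sub, hm, mul_one]
      rw [Finset.sum_congr rfl e2] at hRH
      push_cast at hRH ⊢
      linarith)
    (by
      rw [← Multiset.coe_sumAddMonoidHom, map_sum]
      simp only [Multiset.coe_sumAddMonoidHom, Multiset.sum_replicate, smul_eq_mul]
      zify
      simpa [mul_comm] using hmod)
    (by
      intro p hp hx
      have : p ∣ kOf N d := by
        refine Nat.dvd_gcd hp (Finset.dvd_gcd ?_)
        intro x hx'
        rw [Finset.mem_filter, Finset.mem_Icc] at hx'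
        exact hx x ((hmem x).2 hx')
      rw [hk] at this
      exact Nat.dvd_one.1 this)
  simp only [Set.mem_insert_iff, Set.mem_singleton_iff]
  omega
end
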